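/- arXiv:2008.08082 — 2 statements merged into one kernel-verified Lean document; each statement's English description precedes it below -/
import Mathlib

section
/- For γ > 0, x > 0, y > 0 and α ∈ ℝ, the generalized translation of the power function x ↦ x^α equals ^γT^y_x x^α = (x+y)^α · ₂F₁(−α/2, γ/2; γ; 4xy/(x+y)²), where ₂F₁ is the Gauss hypergeometric function. -/
/-- Pochhammer symbol `(a)_k`. -/
noncomputable def poch (a : ℝ) (k : ℕ) : ℝ := ∏ i ∈ Finset.range k, (a + i)

/-- Gauss hypergeometric function `₂F₁(a,b;c;z)` as a power series. -/
noncomputable def hyp2F1 (a b c z : ℝ) : ℝ :=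
  ∑' k : ℕ, poch a k * poch b k / poch c k * z ^ k / (k.factorial : ℝ)
open MeasureTheory Real

/-- Normalizing constant of the generalized translation. -/
noncomputable def Cgamma (γ : ℝ) : ℝ :=
  Real.Gamma ((γ + 1) / 2) / (Real.sqrt Real.pi * Real.Gamma (γ / 2))

/-- Generalized translation operator `^γT^y_x f(x)`. -/
noncomputable def genTranslation (γ : ℝ) (f : ℝ → ℝ) (x y : ℝ) : ℝ :=
  Cgamma γ *
    ∫ φ in (0:ℝ)..Real.pi,
      f (Real.sqrt (x ^ 2 + y ^ 2 - 2 * x * y * Real.cos φ)) * Real.sin φ ^ (γ - 1)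

lemma aux_abs {μ : Measure ℝ} (c : ℕ → ℝ) (G : ℕ → ℝ → ℝ) (f : ℝ → ℝ)
    (hG : ∀ k, Integrable (G k) μ) (hG0 : ∀ᵐ t ∂μ, ∀ k, 0 ≤ G k t)
    (ε : ℝ) (hε : ε ≠ 0) (N : ℕ) (hc : ∀ k, 0 ≤ ε * c (k + N))
    (hs : ∀ᵐ t ∂μ, HasSum (fun k => c k * G k t) (f t)) :
    ∫ t, f t ∂μ = ∑' k, c k * ∫ t, G k t ∂μ := by
  have hI0 : ∀ k, 0 ≤ ∫ t, G k t ∂μ := fun k =>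
    integral_nonneg_of_ae (hG0.mono fun t h => h k)
  by_cases hS : Summable (fun k => c k * ∫ t, G k t ∂μ)
  · have h := hasSum_integral_of_summable_integral_norm (μ := μ)
      (F := fun k t => c k * G k t) (fun k => (hG k).const_mul _) (by
        refine hS.abs.congr fun k => ?_
        rw [abs_mul, abs_of_nonneg (hI0 k), ← integral_const_mul]
        refine integral_congr_ae (hG0.mono fun t h => ?_)
        simp [abs_of_nonneg (h k)])
    simp_rw [integral_const_mul] at h
    rw [h.tsum_eq]
    exact integral_congr_ae (hs.mono fun t h => h.tsum_eq.symm)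
  · rw [tsum_eq_zero_of_not_summable hS]
    apply integral_undef
    intro hf
    apply hS
    rw [← summable_nat_add_iff N, ← summable_mul_left_iff hε]
    have hint : ∀ i, Integrable (fun t => ε * (c (i + N) * G (i + N) t)) μ := fun i =>
      ((hG _).const_mul _).const_mul _
    refine summable_of_sum_range_le
      (c := ∫ t, ε * (f t - ∑ i ∈ Finset.range N, c i * G i t) ∂μ) ?_ ?_
    · intro k
      rw [← mul_assoc]
      exact mul_nonneg (hc k) (hI0 _)
    · intro n
      have e : ∑ i ∈ Finset.range n, ε * (c (i + N) * ∫ t, G (i + N) t ∂μ)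
          = ∫ t, ∑ i ∈ Finset.range n, ε * (c (i + N) * G (i + N) t) ∂μ := by
        rw [integral_finsetSum _ (fun i _ => hint i)]
        simp_rw [integral_const_mul]
      rw [e]
      refine integral_mono_ae (integrable_finsetSum _ (fun i _ => hint i)) ?_ ?_
      · exact (hf.sub (integrable_finsetSum _ (fun i _ => (hG i).const_mul _))).const_mul _
      · filter_upwards [hG0, hs] with t h0 h1
        have h2 := ((hasSum_nat_add_iff' N).2 h1).mul_left ε
        refine sum_le_hasSum _ (fun i _ => ?_) h2
        rw [← mul_assoc]
        exact mul_nonneg (hc i) (h0 _)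

lemma poch_succ (a : ℝ) (k : ℕ) : poch a (k + 1) = poch a k * (a + k) := by
  simp [poch, Finset.prod_range_succ]

lemma poch_sign (a : ℝ) : ∃ ε : ℝ, ε ≠ 0 ∧ ∃ N : ℕ, ∀ k, 0 ≤ ε * poch a (k + N) := by
  obtain ⟨N, hN⟩ := exists_nat_gt (-a)
  refine ⟨if 0 ≤ poch a N then 1 else -1, by split_ifs <;> norm_num, N, ?_⟩
  intro k
  induction k with
  | zero => split_ifs with h <;> simp <;> linarith
  | succ k ih =>
    rw [show k + 1 + N = (k + N) + 1 by ring, poch_succ, ← mul_assoc]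
    refine mul_nonneg ih ?_
    push_cast
    have : (0:ℝ) ≤ k := by positivity
    linarith

lemma Gamma_poch (a : ℝ) (ha : 0 < a) (k : ℕ) :
    Real.Gamma (a + k) = poch a k * Real.Gamma a := by
  induction k with
  | zero => simp [poch]
  | succ k ih =>
    have : a + k ≠ 0 := by positivity
    push_cast
    rw [← add_assoc, Real.Gamma_add_one this, ih, poch_succ]
    ring

lemma choose_poch (a : ℝ) (k : ℕ) :
    Ring.choose (a + k - 1) k = poch a k / (k.factorial : ℝ) := by
  have h1 : Ring.choose (a + k - 1) k = Ring.multichoose a k := by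
    rw [Ring.choose]; congr 1; ring
  have h2 := Ring.factorial_nsmul_multichoose_eq_ascPochhammer a k
  have h3 : (ascPochhammer ℕ k).smeval a = poch a k := by
    rw [Polynomial.ascPochhammer_smeval_eq_eval]
    clear h1 h2
    induction k with
    | zero => simp [poch]
    | succ k ih => rw [ascPochhammer_succ_eval, poch_succ, ih]
  rw [h1, eq_div_iff (by positivity), ← h3, ← h2, nsmul_eq_mul, mul_comm]

lemma binom_hasSum (a t : ℝ) (h0 : 0 ≤ t) (h1 : t < 1) :
    HasSum (fun k => poch a k / (k.factorial : ℝ) * t ^ k) ((1 - t) ^ (-a)) := by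
  have h := (Real.one_div_one_sub_rpow_hasFPowerSeriesOnBall_zero a).hasSum (y := t) (by
    simpa [Real.enorm_eq_ofReal h0] using h1)
  simp only [FormalMultilinearSeries.ofScalars_apply_eq, choose_poch, zero_add, smul_eq_mul] at h
  rw [Real.rpow_neg (by linarith)]
  simpa using h

lemma beta_real (p q : ℝ) (hp : 0 < p) (hq : 0 < q) :
    ∫ u in Set.Ioo (0:ℝ) 1, u ^ (p - 1) * (1 - u) ^ (q - 1)
      = Real.Gamma p * Real.Gamma q / Real.Gamma (p + q) := by
  have h := ProbabilityTheory.lintegral_betaPDF_eq_one hp hq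
  have hb := ProbabilityTheory.beta_pos hp hq
  rw [ProbabilityTheory.lintegral_betaPDF] at h
  have h2 : ∫ u in Set.Ioo (0:ℝ) 1,
      1 / ProbabilityTheory.beta p q * u ^ (p - 1) * (1 - u) ^ (q - 1) = 1 := by
    rw [integral_eq_lintegral_of_nonneg_ae, h]
    · simp
    · filter_upwards [ae_restrict_mem measurableSet_Ioo] with u hu
      have := hu.1
      have : 0 < 1 - u := by linarith [hu.2]
      simp only [Pi.zero_apply]
      positivity
    · exact Measurable.aestronglyMeasurable (by fun_prop)
  simp_rw [mul_assoc, integral_const_mul] at h2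
  rw [one_div, inv_mul_eq_one₀ hb.ne'] at h2
  rw [← h2]; rfl

lemma img : (fun φ : ℝ => (1 + Real.cos φ) / 2) '' Set.Ioo 0 Real.pi = Set.Ioo 0 1 := by
  ext u
  constructor
  · rintro ⟨φ, hφ, rfl⟩
    have h1 := Real.cos_lt_cos_of_nonneg_of_le_pi le_rfl hφ.2.le hφ.1
    have h2 := Real.cos_lt_cos_of_nonneg_of_le_pi hφ.1.le le_rfl hφ.2
    simp at h1 h2
    constructor <;> simp only <;> linarith
  · rintro ⟨h0, h1⟩
    refine ⟨Real.arccos (2 * u - 1), ⟨Real.arccos_pos.2 (by linarith), ?_⟩, ?_⟩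
    · refine lt_of_le_of_ne (Real.arccos_le_pi _) fun h => ?_
      rw [Real.arccos_eq_pi] at h; linarith
    · simp only
      rw [Real.cos_arccos (by linarith) (by linarith)]; ring

lemma moment (γ : ℝ) (hγ : 0 < γ) (k : ℕ) :
    IntegrableOn (fun φ => ((1 + Real.cos φ) / 2) ^ k * Real.sin φ ^ (γ - 1)) (Set.Ioo 0 Real.pi)
    ∧ Cgamma γ * ∫ φ in Set.Ioo 0 Real.pi, ((1 + Real.cos φ) / 2) ^ k * Real.sin φ ^ (γ - 1)
      = poch (γ / 2) k / poch γ k := by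
  have hd : ∀ φ ∈ Set.Ioo (0:ℝ) Real.pi, HasDerivWithinAt (fun φ : ℝ => (1 + Real.cos φ) / 2)
      (-Real.sin φ / 2) (Set.Ioo 0 Real.pi) φ := fun φ _ =>
    (((Real.hasDerivAt_cos φ).const_add 1).div_const 2).hasDerivWithinAt
  have hinj : Set.InjOn (fun φ : ℝ => (1 + Real.cos φ) / 2) (Set.Ioo 0 Real.pi) := by
    intro a ha b hb h
    simp only at h
    exact Real.injOn_cos ⟨ha.1.le, ha.2.le⟩ ⟨hb.1.le, hb.2.le⟩ (by linarith)
  set g : ℝ → ℝ := fun u => 2 ^ (γ - 1) * (u ^ ((γ / 2 + k) - 1) * (1 - u) ^ (γ / 2 - 1)) with hg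
  have key : Set.EqOn (fun φ => |-Real.sin φ / 2| • g ((1 + Real.cos φ) / 2))
      (fun φ => ((1 + Real.cos φ) / 2) ^ k * Real.sin φ ^ (γ - 1)) (Set.Ioo 0 Real.pi) := by
    intro φ hφ
    have hs := Real.sin_pos_of_mem_Ioo hφ
    have hu : (1 + Real.cos φ) / 2 ∈ Set.Ioo (0:ℝ) 1 := img ▸ Set.mem_image_of_mem _ hφ
    have hsq : Real.sin φ = 2 * (((1 + Real.cos φ) / 2) ^ (1/2:ℝ)
        * (1 - (1 + Real.cos φ) / 2) ^ (1/2:ℝ)) := by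
      rw [← Real.mul_rpow hu.1.le (by linarith [hu.2]), ← Real.sqrt_eq_rpow]
      have : (1 + Real.cos φ) / 2 * (1 - (1 + Real.cos φ) / 2) = (Real.sin φ / 2) ^ 2 := by
        linear_combination (-1/4) * Real.sin_sq_add_cos_sq φ
      rw [this, Real.sqrt_sq (by positivity)]; ring
    have habs : |-Real.sin φ / 2| = Real.sin φ / 2 := by
      rw [neg_div, abs_neg, abs_of_pos (by positivity)]
    simp only [smul_eq_mul, hg, habs]
    set u := (1 + Real.cos φ) / 2
    have h1 : 0 < u := hu.1
    have h2 : 0 < 1 - u := by linarith [hu.2]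
    have e1 : Real.sin φ ^ (γ - 1) = 2 ^ (γ - 1) * (u ^ ((γ-1)/2) * (1-u) ^ ((γ-1)/2)) := by
      rw [hsq, Real.mul_rpow (by norm_num) (by positivity), Real.mul_rpow (by positivity) (by positivity),
        ← Real.rpow_mul h1.le, ← Real.rpow_mul h2.le]
      ring_nf
    have e2 : u ^ (γ / 2 + k - 1) = u ^ k * u ^ ((γ-1)/2) * (u ^ (1/2:ℝ))⁻¹ := by
      rw [← Real.rpow_natCast, ← Real.rpow_neg h1.le, ← Real.rpow_add h1, ← Real.rpow_add h1]
      congr 1; ring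
    have e3 : (1-u) ^ (γ / 2 - 1) = (1-u) ^ ((γ-1)/2) * ((1-u) ^ (1/2:ℝ))⁻¹ := by
      rw [← Real.rpow_neg h2.le, ← Real.rpow_add h2]
      congr 1; ring
    rw [e1, e2, e3]
    rw [hsq]
    have : u ^ (1/2:ℝ) ≠ 0 := by positivity
    have : (1-u) ^ (1/2:ℝ) ≠ 0 := by positivity
    field_simp
  have hb := beta_real (γ / 2 + k) (γ / 2) (by positivity) (by positivity)
  have hpos : 0 < Real.Gamma (γ / 2 + k) * Real.Gamma (γ / 2) / Real.Gamma (γ / 2 + k + γ / 2) :=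
    div_pos (mul_pos (Real.Gamma_pos_of_pos (by positivity)) (Real.Gamma_pos_of_pos (by positivity)))
      (Real.Gamma_pos_of_pos (by positivity))
  have hgi : IntegrableOn g (Set.Ioo 0 1) := by
    refine Integrable.const_mul ?_ _
    by_contra h
    rw [integral_undef h] at hb
    linarith
  constructor
  · rw [← img, integrableOn_image_iff_integrableOn_abs_deriv_smul measurableSet_Ioo hd hinj] at hgi
    exact hgi.congr_fun key measurableSet_Ioo
  · rw [← setIntegral_congr_fun measurableSet_Ioo key,
      ← integral_image_eq_integral_abs_deriv_smul measurableSet_Ioo hd hinj, img, hg,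
      integral_const_mul, hb, Gamma_poch _ (by positivity),
      show γ / 2 + k + γ / 2 = γ + k by ring, Gamma_poch _ hγ, Cgamma]
    have hdup := Real.Gamma_mul_Gamma_add_half (γ / 2)
    rw [show γ / 2 + 1 / 2 = (γ + 1) / 2 by ring, show 2 * (γ / 2) = γ by ring] at hdup
    have hG1 := (Real.Gamma_pos_of_pos hγ).ne'
    have hG2 := (Real.Gamma_pos_of_pos (half_pos hγ)).ne'
    have hp : poch γ k ≠ 0 := by
      refine Finset.prod_ne_zero_iff.2 fun i _ => ?_
      positivity
    have h2 : (2:ℝ) ^ (1 - γ) * 2 ^ (γ - 1) = 1 := by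
      rw [← Real.rpow_add (by norm_num)]; simp
    have hpi : √Real.pi ≠ 0 := by positivity
    field_simp
    linear_combination poch (γ / 2) k * ((2:ℝ) ^ (γ - 1) * hdup + Real.Gamma γ * √Real.pi * h2)

theorem genTranslation_rpow (γ : ℝ) (hγ : 0 < γ) (x y α : ℝ) (hx : 0 < x) (hy : 0 < y) :
    genTranslation γ (fun t => t ^ α) x y =
      (x + y) ^ α * hyp2F1 (-α / 2) (γ / 2) γ (4 * x * y / (x + y) ^ 2) := by
  obtain ⟨ε, hε, N, hN⟩ := poch_sign (-α / 2)
  set z := 4 * x * y / (x + y) ^ 2 with hz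
  have hz0 : 0 ≤ z := by positivity
  have hz1 : z ≤ 1 := by
    rw [hz, div_le_one (by positivity)]; nlinarith [sq_nonneg (x - y)]
  have main := aux_abs (μ := volume.restrict (Set.Ioo 0 Real.pi))
    (fun k => poch (-α / 2) k / (k.factorial : ℝ) * z ^ k)
    (fun k φ => ((1 + Real.cos φ) / 2) ^ k * Real.sin φ ^ (γ - 1))
    (fun φ => (1 - z * ((1 + Real.cos φ) / 2)) ^ (α / 2) * Real.sin φ ^ (γ - 1))
    (fun k => (moment γ hγ k).1)
    (by
      filter_upwards [ae_restrict_mem measurableSet_Ioo] with φ hφ k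
      have hs := Real.sin_pos_of_mem_Ioo hφ
      have hu : (1 + Real.cos φ) / 2 ∈ Set.Ioo (0:ℝ) 1 := img ▸ Set.mem_image_of_mem _ hφ
      have := hu.1
      positivity)
    ε hε N
    (by
      intro k
      have := hN k
      rw [div_mul_eq_mul_div, mul_div_assoc, ← mul_assoc]
      positivity)
    (by
      filter_upwards [ae_restrict_mem measurableSet_Ioo] with φ hφ
      have hu : (1 + Real.cos φ) / 2 ∈ Set.Ioo (0:ℝ) 1 := img ▸ Set.mem_image_of_mem _ hφ
      have h := (binom_hasSum (-α / 2) (z * ((1 + Real.cos φ) / 2)) (mul_nonneg hz0 hu.1.le)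
        (by nlinarith [hu.1, hu.2])).mul_right (Real.sin φ ^ (γ - 1))
      rw [show -(-α / 2) = α / 2 by ring] at h
      have he : (fun k : ℕ => poch (-α / 2) k / (k.factorial : ℝ) * z ^ k *
          (((1 + Real.cos φ) / 2) ^ k * Real.sin φ ^ (γ - 1)))
          = fun i : ℕ => poch (-α / 2) i / (i.factorial : ℝ) * (z * ((1 + Real.cos φ) / 2)) ^ i
            * Real.sin φ ^ (γ - 1) := by
        funext k
        rw [mul_pow]; ring
      simp only [he]
      exact h)
  have hcongr : ∫ φ in (0:ℝ)..Real.pi,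
      (fun t : ℝ => t ^ α) (Real.sqrt (x ^ 2 + y ^ 2 - 2 * x * y * Real.cos φ)) * Real.sin φ ^ (γ - 1)
      = (x + y) ^ α * ∫ φ in Set.Ioo 0 Real.pi,
        (1 - z * ((1 + Real.cos φ) / 2)) ^ (α / 2) * Real.sin φ ^ (γ - 1) := by
    rw [intervalIntegral.integral_of_le Real.pi_pos.le, integral_Ioc_eq_integral_Ioo,
      ← integral_const_mul]
    refine setIntegral_congr_fun measurableSet_Ioo fun φ hφ => ?_
    have hu : (1 + Real.cos φ) / 2 ∈ Set.Ioo (0:ℝ) 1 := img ▸ Set.mem_image_of_mem _ hφ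
    have hq : 0 ≤ 1 - z * ((1 + Real.cos φ) / 2) := by nlinarith [hu.1, hu.2]
    have e : x ^ 2 + y ^ 2 - 2 * x * y * Real.cos φ
        = (x + y) ^ 2 * (1 - z * ((1 + Real.cos φ) / 2)) := by
      rw [hz]; field_simp; ring
    simp only
    rw [e, Real.sqrt_mul (by positivity), Real.sqrt_sq (by positivity),
      Real.mul_rpow (by positivity) (by positivity), Real.sqrt_eq_rpow, ← Real.rpow_mul hq,
      mul_assoc]
    ring_nf
  rw [genTranslation, hcongr, main, hyp2F1, mul_left_comm, ← tsum_mul_left]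
  congr 2
  ext k
  rw [mul_left_comm, (moment γ hγ k).2]
  ring
end

section
/- For α = 0.7 and γ = 0.5 (more generally for γ > 0 and 0 < α < (γ+1)/2), the fractional negative power of the Bessel operator applied to the Gaussian satisfies I^α_γ e^{−x²} = (Γ((γ+1)/2 − α)/(2^{2α} Γ((γ+1)/2))) e^{−x²} ₁F₁(α, (γ+1)/2; x²), where ₁F₁ is the confluent hypergeometric function. -/
/-- Kummer confluent hypergeometric function `₁F₁(a;b;z)`. -/
noncomputable def hyp1F1 (a b z : ℝ) : ℝ :=
  ∑' k : ℕ, poch a k / poch b k * z ^ k / (k.factorial : ℝ)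
open MeasureTheory Real

lemma beta_real_int (u v : ℝ) (hu : 0 < u) (hv : 0 < v) :
    IntegrableOn (fun t : ℝ => t ^ (u - 1) * (1 - t) ^ (v - 1)) (Set.Ioo 0 1) ∧
    ∫ t in Set.Ioo (0:ℝ) 1, t ^ (u - 1) * (1 - t) ^ (v - 1) =
      Real.Gamma u * Real.Gamma v / Real.Gamma (u + v) := by
  have h1 : IntervalIntegrable (fun x : ℝ => (x:ℂ) ^ ((u:ℂ) - 1) * (1 - (x:ℂ)) ^ ((v:ℂ) - 1))
      volume 0 1 := Complex.betaIntegral_convergent (u := u) (v := v) (by simpa) (by simpa)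
  rw [intervalIntegrable_iff_integrableOn_Ioo_of_le zero_le_one] at h1
  have key : ∀ x ∈ Set.Ioo (0:ℝ) 1, ((x:ℂ) ^ ((u:ℂ) - 1) * (1 - (x:ℂ)) ^ ((v:ℂ) - 1)).re =
      x ^ (u - 1) * (1 - x) ^ (v - 1) := by
    intro x hx
    norm_cast
    rw [← Complex.ofReal_cpow hx.1.le, ← Complex.ofReal_cpow (by linarith [hx.2]),
      Complex.re_mul_ofReal, Complex.ofReal_re]
  constructor
  · refine IntegrableOn.congr_fun (f := fun x : ℝ => ((x:ℂ) ^ ((u:ℂ) - 1) * (1 - (x:ℂ)) ^ ((v:ℂ) - 1)).re) ?_ key measurableSet_Ioo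
    exact h1.re
  · have := ProbabilityTheory.beta_eq_betaIntegralReal u v hu hv
    rw [ProbabilityTheory.beta] at this
    rw [this, Complex.betaIntegral, intervalIntegral.integral_of_le (by norm_num),
      integral_Ioc_eq_integral_Ioo, ← RCLike.re_to_complex, ← integral_re h1]
    exact (setIntegral_congr_fun measurableSet_Ioo key).symm

lemma image_cos_sq : (fun φ => Real.cos φ ^ 2) '' Set.Ioo 0 (π / 2) = Set.Ioo 0 1 := by
  ext t
  constructor
  · rintro ⟨φ, ⟨h0, h1⟩, rfl⟩
    have hc : 0 < Real.cos φ := Real.cos_pos_of_mem_Ioo ⟨by linarith, h1⟩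
    have hs : 0 < Real.sin φ := Real.sin_pos_of_pos_of_lt_pi h0 (by linarith)
    have := Real.sin_sq_add_cos_sq φ
    exact ⟨by positivity, by show Real.cos φ ^ 2 < 1; nlinarith⟩
  · rintro ⟨h0, h1⟩
    have hs0 : 0 < √t := Real.sqrt_pos.2 h0
    have hs1 : √t < 1 := by rw [Real.sqrt_lt' one_pos]; simpa
    refine ⟨Real.arccos (√t), ⟨Real.arccos_pos.2 hs1, Real.arccos_lt_pi_div_two.2 hs0⟩, ?_⟩
    simp only
    rw [Real.cos_arccos (by linarith) hs1.le, Real.sq_sqrt h0.le]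

lemma half_int (γ : ℝ) (hγ : 0 < γ) (k : ℕ) :
    IntegrableOn (fun φ : ℝ => Real.cos φ ^ (2 * k) * Real.sin φ ^ (γ - 1)) (Set.Ioo 0 (π / 2)) ∧
    2 * ∫ φ in Set.Ioo (0:ℝ) (π / 2), Real.cos φ ^ (2 * k) * Real.sin φ ^ (γ - 1) =
      Real.Gamma (k + 1 / 2) * Real.Gamma (γ / 2) / Real.Gamma (k + (γ + 1) / 2) := by
  obtain ⟨hb1, hb2⟩ := beta_real_int (k + 1 / 2) (γ / 2) (by positivity) (by positivity)
  have hd : ∀ φ ∈ Set.Ioo (0:ℝ) (π / 2), HasDerivWithinAt (fun φ => Real.cos φ ^ 2)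
      (2 * Real.cos φ * (- Real.sin φ)) (Set.Ioo (0:ℝ) (π / 2)) φ := by
    intro φ _
    have := ((Real.hasDerivAt_cos φ).pow 2).hasDerivWithinAt (s := Set.Ioo (0:ℝ) (π / 2))
    convert! this using 1
    norm_num
  have hinj : Set.InjOn (fun φ => Real.cos φ ^ 2) (Set.Ioo (0:ℝ) (π / 2)) := by
    intro a ha b hb hab
    have hca : 0 < Real.cos a := Real.cos_pos_of_mem_Ioo ⟨by linarith [ha.1, Real.pi_pos], ha.2⟩
    have hcb : 0 < Real.cos b := Real.cos_pos_of_mem_Ioo ⟨by linarith [hb.1, Real.pi_pos], hb.2⟩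
    have h2 : Real.cos a = Real.cos b := by
      simp only at hab
      exact (pow_left_inj₀ hca.le hcb.le two_ne_zero).1 hab
    exact Real.injOn_cos ⟨ha.1.le, by linarith [ha.2, Real.pi_pos]⟩
      ⟨hb.1.le, by linarith [hb.2, Real.pi_pos]⟩ h2
  have key : ∀ φ ∈ Set.Ioo (0:ℝ) (π / 2),
      |2 * Real.cos φ * (- Real.sin φ)| • ((Real.cos φ ^ 2) ^ ((k + 1 / 2 : ℝ) - 1) *
        (1 - Real.cos φ ^ 2) ^ (γ / 2 - 1)) =
      2 * (Real.cos φ ^ (2 * k) * Real.sin φ ^ (γ - 1)) := by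
    intro φ hφ
    have hc : 0 < Real.cos φ := Real.cos_pos_of_mem_Ioo ⟨by linarith [hφ.1, Real.pi_pos], hφ.2⟩
    have hs : 0 < Real.sin φ := Real.sin_pos_of_pos_of_lt_pi hφ.1 (by linarith [hφ.2, Real.pi_pos])
    rw [← Real.sin_sq, mul_neg, abs_neg, abs_of_pos (by positivity), smul_eq_mul,
      ← Real.rpow_natCast, ← Real.rpow_natCast, ← Real.rpow_natCast, ← Real.rpow_mul hc.le,
      ← Real.rpow_mul hs.le]
    have e1 : Real.cos φ ^ (((2 * k : ℕ) : ℝ)) =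
        Real.cos φ * Real.cos φ ^ (((2:ℕ):ℝ) * ((k + 1 / 2 : ℝ) - 1)) := by
      nth_rewrite 2 [← Real.rpow_one (Real.cos φ)]
      rw [← Real.rpow_add hc]; congr 1; push_cast; ring
    have e2 : Real.sin φ ^ (γ - 1) = Real.sin φ * Real.sin φ ^ (((2:ℕ):ℝ) * (γ / 2 - 1)) := by
      nth_rewrite 2 [← Real.rpow_one (Real.sin φ)]
      rw [← Real.rpow_add hs]; congr 1; push_cast; ring
    rw [e1, e2]; ring
  rw [← image_cos_sq] at hb1 hb2
  rw [integrableOn_image_iff_integrableOn_abs_deriv_smul measurableSet_Ioo hd hinj] at hb1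
  rw [integral_image_eq_integral_abs_deriv_smul measurableSet_Ioo hd hinj,
    setIntegral_congr_fun measurableSet_Ioo key, integral_const_mul] at hb2
  have hb1' := hb1.congr_fun key measurableSet_Ioo
  constructor
  · have := hb1'.const_mul (1/2)
    refine IntegrableOn.congr_fun this (fun φ _ => ?_) measurableSet_Ioo
    ring
  · rw [hb2]; congr 2; ring

lemma full_int (γ : ℝ) (hγ : 0 < γ) (k : ℕ) :
    IntervalIntegrable (fun φ : ℝ => Real.cos φ ^ (2 * k) * Real.sin φ ^ (γ - 1)) volume 0 π ∧
    ∫ φ in (0:ℝ)..π, Real.cos φ ^ (2 * k) * Real.sin φ ^ (γ - 1) =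
      Real.Gamma (k + 1 / 2) * Real.Gamma (γ / 2) / Real.Gamma (k + (γ + 1) / 2) := by
  obtain ⟨h1, h2⟩ := half_int γ hγ k
  have hp : (0:ℝ) ≤ π / 2 := by positivity
  rw [← intervalIntegrable_iff_integrableOn_Ioo_of_le hp] at h1
  rw [← integral_Ioc_eq_integral_Ioo, ← intervalIntegral.integral_of_le hp] at h2
  have hsymm : ∀ φ : ℝ, Real.cos (π - φ) ^ (2 * k) * Real.sin (π - φ) ^ (γ - 1) =
      Real.cos φ ^ (2 * k) * Real.sin φ ^ (γ - 1) := by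
    intro φ
    rw [Real.cos_pi_sub, Real.sin_pi_sub, (even_two_mul k).neg_pow]
  have h3 := h1.comp_sub_left π
  simp only [hsymm] at h3
  have e : π - π / 2 = π / 2 := by ring
  rw [sub_zero, e] at h3
  have h4 := intervalIntegral.integral_comp_sub_left (a := 0) (b := π / 2)
    (fun φ : ℝ => Real.cos φ ^ (2 * k) * Real.sin φ ^ (γ - 1)) π
  simp only [hsymm] at h4
  rw [sub_zero, e] at h4
  refine ⟨h1.trans h3.symm, ?_⟩
  rw [← intervalIntegral.integral_add_adjacent_intervals h1 h3.symm, ← h4, ← h2]; ring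

lemma gamma_half (k : ℕ) : Real.Gamma (k + 1 / 2) * 4 ^ k / ((2 * k).factorial : ℝ) =
    √π / (k.factorial : ℝ) := by
  induction k with
  | zero => simp only [Nat.cast_zero, zero_add, Real.Gamma_one_half_eq]; simp
  | succ k ih =>
    have : ((k + 1 : ℕ) : ℝ) + 1 / 2 = (k + 1 / 2) + 1 := by push_cast; ring
    rw [this, Real.Gamma_add_one (by positivity), show 2 * (k + 1) = 2 * k + 1 + 1 by ring,
      Nat.factorial_succ, Nat.factorial_succ, Nat.factorial_succ, pow_succ]
    push_cast
    have h1 : ((2 * k).factorial : ℝ) ≠ 0 := by positivity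
    have h2 : (k.factorial : ℝ) ≠ 0 := by positivity
    rw [div_eq_div_iff h1 h2] at ih
    rw [div_eq_div_iff (by positivity) (by positivity)]
    linear_combination (2 * (2 * (k:ℝ) + 1) * (k + 1)) * ih

lemma gamma_poch (a : ℝ) (ha : 0 < a) (k : ℕ) :
    Real.Gamma (k + a) = poch a k * Real.Gamma a := by
  induction k with
  | zero => simp [poch]
  | succ k ih =>
    have : ((k + 1 : ℕ) : ℝ) + a = (k + a) + 1 := by push_cast; ring
    rw [this, Real.Gamma_add_one (by positivity), ih, poch, poch, Finset.prod_range_succ]; ring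

lemma poch_pos (a : ℝ) (ha : 0 < a) (k : ℕ) : 0 < poch a k :=
  Finset.prod_pos fun i _ => by positivity

lemma poch_le (a b : ℝ) (ha : 0 < a) (hab : a < b) (k : ℕ) : poch a k ≤ poch b k :=
  Finset.prod_le_prod (fun i _ => by positivity) (fun i _ => by linarith)

lemma hyp_summable (a b z : ℝ) (ha : 0 < a) (hab : a < b) (hz : 0 ≤ z) :
    Summable fun k : ℕ => poch a k / poch b k * z ^ k / (k.factorial : ℝ) := by
  refine Summable.of_nonneg_of_le (fun k => ?_) (fun k => ?_) (Real.summable_pow_div_factorial z)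
  · have := poch_pos a ha k
    have := poch_pos b (ha.trans hab) k
    positivity
  · have h := poch_pos b (ha.trans hab) k
    have : poch a k / poch b k ≤ 1 := (div_le_one h).2 (poch_le a b ha hab k)
    gcongr
    exact mul_le_of_le_one_left (by positivity) this

lemma exp_to_cosh (γ : ℝ) (hγ : 0 < γ) (z : ℝ) :
    ∫ φ in (0:ℝ)..π, Real.exp (z * Real.cos φ) * Real.sin φ ^ (γ - 1) =
    ∫ φ in (0:ℝ)..π, Real.cosh (z * Real.cos φ) * Real.sin φ ^ (γ - 1) := by
  have h0 := (full_int γ hγ 0).1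
  simp only [mul_zero, pow_zero, one_mul] at h0
  have hI : ∀ w : ℝ, IntervalIntegrable (fun φ => Real.exp (w * Real.cos φ) * Real.sin φ ^ (γ - 1))
      volume 0 π := fun w => h0.continuousOn_mul (by fun_prop)
  have h4 := intervalIntegral.integral_comp_sub_left (a := 0) (b := π)
    (fun φ : ℝ => Real.exp (z * Real.cos φ) * Real.sin φ ^ (γ - 1)) π
  simp only [Real.cos_pi_sub, Real.sin_pi_sub, sub_zero, sub_self] at h4
  have : ∀ φ : ℝ, Real.cosh (z * Real.cos φ) * Real.sin φ ^ (γ - 1) =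
    (1/2) * (Real.exp (z * Real.cos φ) * Real.sin φ ^ (γ - 1) +
      Real.exp ((-z) * Real.cos φ) * Real.sin φ ^ (γ - 1)) := by
    intro φ
    rw [Real.cosh_eq, neg_mul]; ring
  simp only [this]
  rw [intervalIntegral.integral_const_mul, intervalIntegral.integral_add (hI z) (hI (-z))]
  simp only [mul_neg, neg_mul] at h4 ⊢
  rw [h4]; ring

lemma hasSum_cosh_int (γ : ℝ) (hγ : 0 < γ) (z : ℝ) :
    HasSum (fun k : ℕ => z ^ (2 * k) / ((2 * k).factorial : ℝ) *
      (Real.Gamma (k + 1 / 2) * Real.Gamma (γ / 2) / Real.Gamma (k + (γ + 1) / 2)))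
    (∫ φ in (0:ℝ)..π, Real.exp (z * Real.cos φ) * Real.sin φ ^ (γ - 1)) := by
  rw [exp_to_cosh γ hγ]
  have hp := Real.pi_pos.le
  have hsin : ∀ φ ∈ Set.Ioc (0:ℝ) π, 0 ≤ Real.sin φ := fun φ h => 
    Real.sin_nonneg_of_nonneg_of_le_pi h.1.le h.2
  let F : ℕ → ℝ → ℝ := fun k φ => z ^ (2 * k) / ((2 * k).factorial : ℝ) *
    (Real.cos φ ^ (2 * k) * Real.sin φ ^ (γ - 1))
  have hFi : ∀ k, Integrable (F k) (volume.restrict (Set.Ioc 0 π)) := by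
    intro k
    have := (full_int γ hγ k).1
    rw [intervalIntegrable_iff_integrableOn_Ioc_of_le hp] at this
    exact this.const_mul _
  have hz : ∀ k : ℕ, 0 ≤ z ^ (2 * k) := fun k => (even_two_mul k).pow_nonneg z
  have hF0 : ∀ k, ∀ φ ∈ Set.Ioc (0:ℝ) π, 0 ≤ F k φ := by
    intro k φ h
    have h1 := hz k
    have h2 : 0 ≤ Real.cos φ ^ (2 * k) := (even_two_mul k).pow_nonneg _
    have h3 := Real.rpow_nonneg (hsin φ h) (γ - 1)
    simp only [F]; positivity
  have hnorm : ∀ k, ∫ φ in Set.Ioc 0 π, ‖F k φ‖ = ∫ φ in Set.Ioc 0 π, F k φ := fun k =>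
    setIntegral_congr_fun measurableSet_Ioc fun φ h => Real.norm_of_nonneg (hF0 k φ h)
  have hval : ∀ k, ∫ φ in Set.Ioc 0 π, F k φ = z ^ (2 * k) / ((2 * k).factorial : ℝ) *
      (Real.Gamma (k + 1 / 2) * Real.Gamma (γ / 2) / Real.Gamma (k + (γ + 1) / 2)) := by
    intro k
    rw [← (full_int γ hγ k).2, intervalIntegral.integral_of_le hp, ← integral_const_mul]
  have hsum : Summable fun k => ∫ φ in Set.Ioc 0 π, ‖F k φ‖ := by
    simp only [hnorm]
    have hs := ((Real.hasSum_cosh z).summable).mul_right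
      (∫ φ in Set.Ioc 0 π, Real.sin φ ^ (γ - 1))
    refine Summable.of_nonneg_of_le (fun k => setIntegral_nonneg measurableSet_Ioc (hF0 k))
      (fun k => ?_) hs
    rw [← integral_const_mul]
    have h0 := (full_int γ hγ 0).1
    rw [intervalIntegrable_iff_integrableOn_Ioc_of_le hp] at h0
    simp only [mul_zero, pow_zero, one_mul] at h0
    refine setIntegral_mono_on (hFi k) (h0.const_mul _) measurableSet_Ioc fun φ h => ?_
    have h1 := hz k
    have h2 : Real.cos φ ^ (2 * k) ≤ 1 := by
      rw [pow_mul]; exact pow_le_one₀ (sq_nonneg _) (Real.cos_sq_le_one φ)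
    have h3 := Real.rpow_nonneg (hsin φ h) (γ - 1)
    simp only [F]
    gcongr
    exact mul_le_of_le_one_left h3 h2
  have := hasSum_integral_of_summable_integral_norm hFi hsum
  simp only [hval] at this
  rw [intervalIntegral.integral_of_le hp]
  suffices e : ∫ φ in Set.Ioc 0 π, Real.cosh (z * Real.cos φ) * Real.sin φ ^ (γ - 1) =
      ∫ φ in Set.Ioc 0 π, ∑' k, F k φ by
    rw [e]; exact this
  refine setIntegral_congr_fun measurableSet_Ioc fun φ h => ?_
  simp only [F]
  rw [← ((Real.hasSum_cosh (z * Real.cos φ)).mul_right (Real.sin φ ^ (γ - 1))).tsum_eq]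
  refine tsum_congr fun k => ?_
  rw [mul_pow]; ring

lemma hasSum_trans (γ : ℝ) (hγ : 0 < γ) (x y : ℝ) :
    HasSum (fun k : ℕ => Real.exp (-x ^ 2) * ((x ^ 2) ^ k / ((k.factorial : ℝ) * poch ((γ + 1) / 2) k))
      * (y ^ (2 * k) * Real.exp (-y ^ 2)))
    (genTranslation γ (fun t => Real.exp (-t ^ 2)) x y) := by
  have h := (hasSum_cosh_int γ hγ (2 * x * y)).mul_left
    (Cgamma γ * (Real.exp (-x ^ 2) * Real.exp (-y ^ 2)))
  have e : genTranslation γ (fun t => Real.exp (-t ^ 2)) x y =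
      Cgamma γ * (Real.exp (-x ^ 2) * Real.exp (-y ^ 2)) *
      ∫ φ in (0:ℝ)..π, Real.exp (2 * x * y * Real.cos φ) * Real.sin φ ^ (γ - 1) := by
    rw [genTranslation, mul_assoc (Cgamma γ) (Real.exp (-x ^ 2) * Real.exp (-y ^ 2))]
    congr 1
    rw [← intervalIntegral.integral_const_mul]
    refine intervalIntegral.integral_congr fun φ _ => ?_
    have hn : 0 ≤ x ^ 2 + y ^ 2 - 2 * x * y * Real.cos φ := by
      nlinarith [sq_nonneg (x - y * Real.cos φ), sq_nonneg (y * Real.sin φ),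
        Real.sin_sq_add_cos_sq φ, sq_nonneg y]
    rw [Real.sq_sqrt hn, ← mul_assoc, ← Real.exp_add, ← Real.exp_add]
    congr 2; ring
  rw [e]
  refine Eq.subst (motive := fun f => HasSum f _) (funext fun k => ?_) h
  symm
  have hb : 0 < (γ + 1) / 2 := by positivity
  have h1 := (Real.Gamma_pos_of_pos hb).ne'
  have h2 := (Real.Gamma_pos_of_pos (half_pos hγ)).ne'
  have h3 := (poch_pos _ hb k).ne'
  have h4 := gamma_half k
  have h5 : (k.factorial : ℝ) ≠ 0 := by positivity
  have h6 : ((2 * k).factorial : ℝ) ≠ 0 := by positivity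
  have h7 : √π ≠ 0 := by positivity
  rw [gamma_poch _ hb, Cgamma]
  have h8 : (2 * x * y) ^ (2 * k) = 4 ^ k * (x ^ 2) ^ k * y ^ (2 * k) := by
    rw [pow_mul, pow_mul, ← mul_pow, ← mul_pow]; congr 1; ring
  rw [h8]
  have h9 : Real.Gamma (k + 1 / 2) = √π / (k.factorial : ℝ) * ((2 * k).factorial : ℝ) / 4 ^ k := by
    rw [← h4]; field_simp
  rw [h9]
  field_simp

lemma main_int (γ α : ℝ) (hγ : 0 < γ) (hα : 0 < α)
    (hα' : α < (γ + 1) / 2) (x : ℝ) :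
    ∫ y in Set.Ioi (0:ℝ), genTranslation γ (fun t => Real.exp (-t ^ 2)) x y * y ^ (2 * α - 1) =
     Real.Gamma α / 2 * Real.exp (-x ^ 2) * hyp1F1 α ((γ + 1) / 2) (x ^ 2) := by
  have hb : 0 < (γ + 1) / 2 := by positivity
  let c : ℕ → ℝ := fun k => Real.exp (-x ^ 2) * ((x ^ 2) ^ k / ((k.factorial : ℝ) * poch ((γ + 1) / 2) k))
  have hc : ∀ k, 0 ≤ c k := fun k => by
    have := poch_pos _ hb k
    simp only [c]; positivity
  let G : ℕ → ℝ → ℝ := fun k y => c k * (y ^ (2 * k + 2 * α - 1) * Real.exp (-y ^ (2:ℝ)))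
  have hq : ∀ k : ℕ, -1 < 2 * (k:ℝ) + 2 * α - 1 := fun k => by
    have : (0:ℝ) ≤ k := by positivity
    linarith
  have hGi : ∀ k, Integrable (G k) (volume.restrict (Set.Ioi 0)) := fun k =>
    (integrableOn_rpow_mul_exp_neg_rpow (hq k) two_pos).const_mul _
  have hval : ∀ k, ∫ y in Set.Ioi 0, G k y = Real.Gamma α / 2 * Real.exp (-x ^ 2) *
      (poch α k / poch ((γ + 1) / 2) k * (x ^ 2) ^ k / (k.factorial : ℝ)) := by
    intro k
    simp only [G]
    rw [integral_const_mul, integral_rpow_mul_exp_neg_rpow two_pos (hq k),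
      show (2 * (k:ℝ) + 2 * α - 1 + 1) / 2 = k + α by ring, gamma_poch α hα]
    have := (poch_pos _ hb k).ne'
    simp only [c]
    field_simp
  have hnorm : ∀ k, ∫ y in Set.Ioi 0, ‖G k y‖ = ∫ y in Set.Ioi 0, G k y := fun k =>
    setIntegral_congr_fun measurableSet_Ioi fun y h => Real.norm_of_nonneg (by
      have h1 := hc k
      have h2 := Real.rpow_nonneg (le_of_lt h) (2 * (k:ℝ) + 2 * α - 1)
      simp only [G]; positivity)
  have hsum : Summable fun k => ∫ y in Set.Ioi 0, ‖G k y‖ := by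
    simp only [hnorm, hval]
    exact (hyp_summable α _ (x ^ 2) hα hα' (sq_nonneg x)).mul_left _
  have := (hasSum_integral_of_summable_integral_norm hGi hsum).tsum_eq
  simp only [hval] at this
  rw [tsum_mul_left] at this
  rw [hyp1F1, this]
  refine setIntegral_congr_fun measurableSet_Ioi fun y h => ?_
  rw [← ((hasSum_trans γ hγ x y).mul_right (y ^ (2 * α - 1))).tsum_eq]
  refine tsum_congr fun k => ?_
  have hy : 0 < y := h
  simp only [G, c]
  have e1 : y ^ (2 * (k:ℝ) + 2 * α - 1) = y ^ (2 * k) * y ^ (2 * α - 1) := by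
    rw [← Real.rpow_natCast y (2 * k), ← Real.rpow_add hy]; congr 1; push_cast; ring
  rw [e1, Real.rpow_two]; ring

theorem riesz_bessel_potential_gaussian (γ α : ℝ) (hγ : 0 < γ) (hα : 0 < α)
    (hα' : α < (γ + 1) / 2) (x : ℝ) (hx : 0 < x) :
    (2 : ℝ) ^ (1 - 2 * α) * Real.Gamma ((γ + 1) / 2 - α) /
        (Real.Gamma ((γ + 1) / 2) * Real.Gamma α) *
        ∫ y in Set.Ioi (0:ℝ),
          genTranslation γ (fun t => Real.exp (-t ^ 2)) x y * y ^ (2 * α - 1) =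
      Real.Gamma ((γ + 1) / 2 - α) / ((2 : ℝ) ^ (2 * α) * Real.Gamma ((γ + 1) / 2)) *
        Real.exp (-x ^ 2) * hyp1F1 α ((γ + 1) / 2) (x ^ 2) := by
  rw [main_int γ α hγ hα hα' x]
  have hb : 0 < (γ + 1) / 2 := by positivity
  have h1 := (Real.Gamma_pos_of_pos hb).ne'
  have h2 := (Real.Gamma_pos_of_pos hα).ne'
  rw [Real.rpow_sub two_pos, Real.rpow_one]
  have h3 : (2:ℝ) ^ (2 * α) ≠ 0 := (Real.rpow_pos_of_pos two_pos _).ne'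
  field_simp
end
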